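/- Let U be an orbifold atlas of dimension n on X, let λ_nl : (Ũ_n, G_n, π_n) → (Ũ_l, G_l, π_l) and λ_pl : (Ũ_p, G_p, π_p) → (Ũ_l, G_l, π_l) be embeddings between charts of U, and let x̃_n ∈ Ũ_n, x̃_p ∈ Ũ_p be points with λ_nl(x̃_n) = λ_pl(x̃_p). Then there exist a chart (Ũ_q, G_q, π_q) of U, a point x̃_q ∈ Ũ_q and embeddings λ_qn : (Ũ_q, G_q, π_q) → (Ũ_n, G_n, π_n), λ_qp : (Ũ_q, G_q, π_q) → (Ũ_p, G_p, π_p) such that λ_nl ∘ λ_qn = λ_pl ∘ λ_qp, λ_qn(x̃_q) = x̃_n and λ_qp(x̃_q) = x̃_p. -/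

import Mathlib

open Set

noncomputable section

/-- `ℂⁿ`. -/
abbrev CC (n : ℕ) : Type := EuclideanSpace ℂ (Fin n)

/-- A (reduced complex) uniformizing system of dimension `n` for the open set
`U := p '' Ut` of `X`: `Ut ⊆ ℂⁿ` is a nonempty connected open set, `G` is a finite
group of holomorphic automorphisms of `Ut` (encoded as total maps that agree with the
identity outside `Ut`, so that `G` is honestly a set of maps closed under composition
and inversion), and `p` (the map `π`) is continuous, surjective and `G`-invariant on
`Ut`, inducing a homeomorphism `Ut/G ≃ U` (encoded by: the fibres of `p` on `Ut` are
exactly the `G`-orbits and `p` is an open map on `Ut`). -/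
structure UniformizingSystem (n : ℕ) (X : Type*) [TopologicalSpace X] where
  Ut : Set (CC n)
  isOpen_Ut : IsOpen Ut
  isConnected_Ut : IsConnected Ut
  G : Set (CC n → CC n)
  finite_G : G.Finite
  id_mem_G : (id : CC n → CC n) ∈ G
  comp_mem_G : ∀ g ∈ G, ∀ h ∈ G, (g ∘ h) ∈ G
  inv_mem_G : ∀ g ∈ G, ∃ g' ∈ G, (∀ x, g' (g x) = x) ∧ (∀ x, g (g' x) = x)
  mapsTo_G : ∀ g ∈ G, Set.MapsTo g Ut Ut
  eqOn_id_G : ∀ g ∈ G, Set.EqOn g id Utᶜ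
  analytic_G : ∀ g ∈ G, AnalyticOnNhd ℂ g Ut
  p : CC n → X
  continuousOn_p : ContinuousOn p Ut
  isOpen_image_p : IsOpen (p '' Ut)
  invariant_p : ∀ g ∈ G, ∀ x ∈ Ut, p (g x) = p x
  exists_g_of_p_eq : ∀ x ∈ Ut, ∀ y ∈ Ut, p x = p y → ∃ g ∈ G, g x = y
  isOpenMap_p : ∀ V : Set (CC n), V ⊆ Ut → IsOpen V → IsOpen (p '' V)

/-- The underlying open subset of `X` uniformized by the system. -/
def UniformizingSystem.U {n : ℕ} {X : Type*} [TopologicalSpace X]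
    (𝒰 : UniformizingSystem n X) : Set X := 𝒰.p '' 𝒰.Ut

/-- An embedding `l : (Ũ,G,π) → (Ṽ,H,φ)` of uniformizing systems: a holomorphic
embedding (injective, biholomorphism onto its open image) with `φ ∘ l = π` on `Ũ`. -/
structure IsUSEmbedding {n : ℕ} {X : Type*} [TopologicalSpace X]
    (𝒰 𝒱 : UniformizingSystem n X) (l : CC n → CC n) : Prop where
  mapsTo : Set.MapsTo l 𝒰.Ut 𝒱.Ut
  injOn : Set.InjOn l 𝒰.Ut
  analyticOn : AnalyticOnNhd ℂ l 𝒰.Ut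
  isOpen_image : IsOpen (l '' 𝒰.Ut)
  exists_analytic_inv : ∃ m : CC n → CC n,
    AnalyticOnNhd ℂ m (l '' 𝒰.Ut) ∧ ∀ x ∈ 𝒰.Ut, m (l x) = x
  comp_p : ∀ x ∈ 𝒰.Ut, 𝒱.p (l x) = 𝒰.p x

/-- A (reduced complex) orbifold atlas of dimension `n` on `X`: a family of
uniformizing systems whose underlying open sets cover `X`, such that any two charts
are compatible at every point of the intersection of their underlying open sets. -/
structure OrbifoldAtlas (n : ℕ) (X : Type*) [TopologicalSpace X] where
  I : Type
  chart : I → UniformizingSystem n X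
  covers : ∀ x : X, ∃ i : I, x ∈ (chart i).U
  compat : ∀ i j : I, ∀ x ∈ (chart i).U ∩ (chart j).U,
    ∃ k : I, x ∈ (chart k).U ∧ (chart k).U ⊆ (chart i).U ∩ (chart j).U ∧
      (∃ l, IsUSEmbedding (chart k) (chart i) l) ∧
      (∃ l, IsUSEmbedding (chart k) (chart j) l)

/-- If, at each point of a nonempty open set, `f` agrees with one of finitely many continuous
functions, then it agrees with one of them on a nonempty open subset. -/
theorem exists_eventuallyEq_of_finite {ι E F : Type*} [TopologicalSpace E] [TopologicalSpace F]
    [T2Space F] {s : Set ι} (hs : s.Finite) {f : E → F} {g : ι → E → F} {N : Set E}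
    (hN : IsOpen N) (hne : N.Nonempty) (hf : ContinuousOn f N)
    (hg : ∀ i ∈ s, ContinuousOn (g i) N) (hcov : ∀ x ∈ N, ∃ i ∈ s, f x = g i x) :
    ∃ i ∈ s, ∃ x ∈ N, f =ᶠ[nhds x] g i := by
  induction s, hs using Set.Finite.induction_on generalizing N with
  | empty =>
    obtain ⟨x, hx⟩ := hne
    obtain ⟨i, hi, -⟩ := hcov x hx
    exact hi.elim
  | @insert a s _ _ ih =>
    by_cases h : ∀ x ∈ N, f x = g a x
    · obtain ⟨x, hx⟩ := hne
      exact ⟨a, mem_insert a s, x, hx, Filter.eventuallyEq_of_mem (hN.mem_nhds hx) h⟩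
    · push Not at h
      obtain ⟨x, hx, hxa⟩ := h
      have hopen : IsOpen (N ∩ {y | f y ≠ g a y}) :=
        (hf.prodMk (hg a (mem_insert a s))).isOpen_inter_preimage hN
          isClosed_diagonal.isOpen_compl
      obtain ⟨i, hi, y, hy, hfy⟩ := ih hopen ⟨x, hx, hxa⟩ (hf.mono inter_subset_left)
        (fun i hi ↦ (hg i (mem_insert_of_mem a hi)).mono inter_subset_left)
        (fun y hy ↦ by
          obtain ⟨i, hi, hyi⟩ := hcov y hy.1
          rcases hi with rfl | hi
          · exact (hy.2 hyi).elim
          · exact ⟨i, hi, hyi⟩)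
      exact ⟨i, mem_insert_of_mem a hi, y, hy.1, hfy⟩

section

variable {n : ℕ} {X : Type*} [TopologicalSpace X] {𝒰 𝒱 𝒲 : UniformizingSystem n X}

theorem UniformizingSystem.isUSEmbedding_of_mem_G {g : CC n → CC n} (hg : g ∈ 𝒰.G) :
    IsUSEmbedding 𝒰 𝒰 g := by
  obtain ⟨g', hg', hl, hr⟩ := 𝒰.inv_mem_G g hg
  have himage : g '' 𝒰.Ut = 𝒰.Ut :=
    (𝒰.mapsTo_G g hg).image_subset.antisymm fun x hx ↦ ⟨g' x, 𝒰.mapsTo_G g' hg' hx, hr x⟩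
  exact
    { mapsTo := 𝒰.mapsTo_G g hg
      injOn := (Function.LeftInverse.injective hl).injOn
      analyticOn := 𝒰.analytic_G g hg
      isOpen_image := himage.symm ▸ 𝒰.isOpen_Ut
      exists_analytic_inv := ⟨g', himage.symm ▸ 𝒰.analytic_G g' hg', fun x _ ↦ hl x⟩
      comp_p := 𝒰.invariant_p g hg }

theorem IsUSEmbedding.comp {l k : CC n → CC n} (hl : IsUSEmbedding 𝒱 𝒲 l)
    (hk : IsUSEmbedding 𝒰 𝒱 k) : IsUSEmbedding 𝒰 𝒲 (l ∘ k) := by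
  obtain ⟨m, hm, hml⟩ := hl.exists_analytic_inv
  obtain ⟨m', hm', hmk⟩ := hk.exists_analytic_inv
  have hsub : l ∘ k '' 𝒰.Ut ⊆ l '' 𝒱.Ut := by
    rintro _ ⟨x, hx, rfl⟩
    exact ⟨k x, hk.mapsTo hx, rfl⟩
  have himage : l ∘ k '' 𝒰.Ut = l '' 𝒱.Ut ∩ m ⁻¹' (k '' 𝒰.Ut) := by
    ext z
    constructor
    · intro hz
      refine ⟨hsub hz, ?_⟩
      obtain ⟨x, hx, rfl⟩ := hz
      exact ⟨x, hx, (hml _ (hk.mapsTo hx)).symm⟩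
    · rintro ⟨⟨y, hy, rfl⟩, x, hx, hxy⟩
      exact ⟨x, hx, congrArg l (hxy.trans (hml y hy))⟩
  exact
    { mapsTo := hl.mapsTo.comp hk.mapsTo
      injOn := hl.injOn.comp hk.injOn hk.mapsTo
      analyticOn := hl.analyticOn.comp hk.analyticOn hk.mapsTo
      isOpen_image := himage ▸ hm.continuousOn.isOpen_inter_preimage hl.isOpen_image hk.isOpen_image
      exists_analytic_inv := ⟨m' ∘ m,
        hm'.comp (hm.mono hsub) fun z hz ↦ (himage.subset hz).2,
        fun x hx ↦ by simp [hml _ (hk.mapsTo hx), hmk x hx]⟩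
      comp_p := fun x hx ↦ (hl.comp_p _ (hk.mapsTo hx)).trans (hk.comp_p x hx) }

/-- Two embeddings whose images meet differ by an element of the group of the source. -/
theorem IsUSEmbedding.exists_eqOn_comp {l k : CC n → CC n} (hl : IsUSEmbedding 𝒰 𝒱 l)
    (hk : IsUSEmbedding 𝒰 𝒱 k) (hne : (l '' 𝒰.Ut ∩ k '' 𝒰.Ut).Nonempty) :
    ∃ h ∈ 𝒰.G, EqOn l (k ∘ h) 𝒰.Ut := by
  have han (h) (hh : h ∈ 𝒰.G) : AnalyticOnNhd ℂ (k ∘ h) 𝒰.Ut :=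
    hk.analyticOn.comp (𝒰.analytic_G h hh) (𝒰.mapsTo_G h hh)
  obtain ⟨_, ⟨x, hx, rfl⟩, hxk⟩ := hne
  obtain ⟨h, hh, y, hy, heq⟩ := exists_eventuallyEq_of_finite 𝒰.finite_G (f := l)
    (g := fun h ↦ k ∘ h) (hl.analyticOn.continuousOn.isOpen_inter_preimage 𝒰.isOpen_Ut
      hk.isOpen_image) ⟨x, hx, hxk⟩ (hl.analyticOn.continuousOn.mono inter_subset_left)
    (fun h hh ↦ (han h hh).continuousOn.mono inter_subset_left) (by
      rintro y ⟨hy, w, hw, hwy⟩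
      have hp : 𝒰.p y = 𝒰.p w := by rw [← hl.comp_p y hy, ← hk.comp_p w hw, hwy]
      obtain ⟨h, hh, rfl⟩ := 𝒰.exists_g_of_p_eq y hy w hw hp
      exact ⟨h, hh, hwy.symm⟩)
  exact ⟨h, hh, hl.analyticOn.eqOn_of_preconnected_of_eventuallyEq (han h hh)
    𝒰.isConnected_Ut.isPreconnected hy.1 heq⟩

/-- An embedding can be corrected by the group of the target so as to send a given point to
any point of the fibre over the same point of `X`. -/
theorem IsUSEmbedding.exists_apply_eq {l : CC n → CC n} (hl : IsUSEmbedding 𝒰 𝒱 l)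
    {x y : CC n} (hx : x ∈ 𝒰.Ut) (hy : y ∈ 𝒱.Ut) (hxy : 𝒰.p x = 𝒱.p y) :
    ∃ k, IsUSEmbedding 𝒰 𝒱 k ∧ k x = y := by
  obtain ⟨g, hg, hgy⟩ := 𝒱.exists_g_of_p_eq (l x) (hl.mapsTo hx) y hy
    ((hl.comp_p x hx).trans hxy)
  exact ⟨g ∘ l, (UniformizingSystem.isUSEmbedding_of_mem_G hg).comp hl, hgy⟩

end

/-- Given embeddings `λ_nl : chart a → chart c` and `λ_pl : chart b → chart c` of an
orbifold atlas `𝒰` and points `x̃_n ∈ Ũ_a`, `x̃_p ∈ Ũ_b` with `λ_nl(x̃_n) = λ_pl(x̃_p)`,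
there are a chart `q` of `𝒰`, a point `x̃_q ∈ Ũ_q` and embeddings `λ_qn, λ_qp` with
`λ_nl ∘ λ_qn = λ_pl ∘ λ_qp` (on `Ũ_q`), `λ_qn(x̃_q) = x̃_n` and `λ_qp(x̃_q) = x̃_p`. -/
theorem statement11 {n : ℕ} {X : Type*} [TopologicalSpace X] [T2Space X]
    [SecondCountableTopology X] [ParacompactSpace X]
    (𝒰 : OrbifoldAtlas n X) (a b c : 𝒰.I)
    (lnl lpl : CC n → CC n)
    (hnl : IsUSEmbedding (𝒰.chart a) (𝒰.chart c) lnl)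
    (hpl : IsUSEmbedding (𝒰.chart b) (𝒰.chart c) lpl)
    (xn xp : CC n) (hxn : xn ∈ (𝒰.chart a).Ut) (hxp : xp ∈ (𝒰.chart b).Ut)
    (heq : lnl xn = lpl xp) :
    ∃ (q : 𝒰.I) (xq : CC n) (lqn lqp : CC n → CC n),
      xq ∈ (𝒰.chart q).Ut ∧
      IsUSEmbedding (𝒰.chart q) (𝒰.chart a) lqn ∧
      IsUSEmbedding (𝒰.chart q) (𝒰.chart b) lqp ∧
      (∀ y ∈ (𝒰.chart q).Ut, lnl (lqn y) = lpl (lqp y)) ∧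
      lqn xq = xn ∧ lqp xq = xp := by
  have hp : (𝒰.chart a).p xn = (𝒰.chart b).p xp := by
    rw [← hnl.comp_p xn hxn, ← hpl.comp_p xp hxp, heq]
  obtain ⟨q, ⟨y, hy, hyx⟩, -, ⟨l, hl⟩, ⟨k, hk⟩⟩ :=
    𝒰.compat a b ((𝒰.chart a).p xn) ⟨⟨xn, hxn, rfl⟩, ⟨xp, hxp, hp.symm⟩⟩
  obtain ⟨α, hα, hαy⟩ := hl.exists_apply_eq hy hxn hyx
  obtain ⟨β, hβ, hβy⟩ := hk.exists_apply_eq hy hxp (hyx.trans hp)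
  have hy_eq : (lnl ∘ α) y = (lpl ∘ β) y := by simp [hαy, hβy, heq]
  obtain ⟨h, hh, heqOn⟩ := (hnl.comp hα).exists_eqOn_comp (hpl.comp hβ)
    ⟨_, mem_image_of_mem _ hy, hy_eq ▸ mem_image_of_mem _ hy⟩
  have hhy : h y = y := (hpl.comp hβ).injOn ((𝒰.chart q).mapsTo_G h hh hy) hy
    ((heqOn hy).symm.trans hy_eq)
  exact ⟨q, y, α, β ∘ h, hy, hα, hβ.comp (UniformizingSystem.isUSEmbedding_of_mem_G hh),
    fun _ hz ↦ heqOn hz, hαy, by simp [hhy, hβy]⟩
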